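/- Let w ∈ A₁ be a weight on ℝⁿ and let b satisfy ‖b‖_{BMO_{1,w}} := sup_Q (1/w(Q)) ∫_Q |b − b_Q| dx < ∞. Then there is a constant c (dimensional) such that for every cube Q, the Luxemburg norm of (b − b_Q)/w in the Orlicz space exp L with respect to the probability measure w dx / w(Q) on Q satisfies ‖(b − b_Q)/w‖_{exp L(Q, w)} ≤ c [w]_{A₁} ‖b‖_{BMO_{1,w}}. -/

import Mathlib

open MeasureTheory ENNReal Set

noncomputable section

/-- The axis-parallel cube in `ℝⁿ` with lower corner `a` and side length `h`. -/
def Cube {n : ℕ} (a : Fin n → ℝ) (h : ℝ) : Set (Fin n → ℝ) :=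
  Set.univ.pi fun i => Set.Icc (a i) (a i + h)

/-- The concentric double `2Q` of the cube with lower corner `a` and side length `h`. -/
def Cube2 {n : ℕ} (a : Fin n → ℝ) (h : ℝ) : Set (Fin n → ℝ) :=
  Cube (fun i => a i - h / 2) (2 * h)

/-- The average `f_Q` of `f` over the cube with lower corner `a` and side length `h`. -/
def cubeAvg {n : ℕ} (a : Fin n → ℝ) (h : ℝ) (f : (Fin n → ℝ) → ℝ) : ℝ :=
  ⨍ x in Cube a h, f x

/-- The (uncentered) Hardy–Littlewood maximal function over axis-parallel cubes. -/
def maxFn {n : ℕ} (f : (Fin n → ℝ) → ℝ) (x : Fin n → ℝ) : ℝ≥0∞ :=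
  ⨆ (a : Fin n → ℝ) (h : ℝ) (_ : 0 < h) (_ : x ∈ Cube a h),
    (∫⁻ y in Cube a h, ENNReal.ofReal |f y|) / volume (Cube a h)

/-- The BMO seminorm `sup_Q (1/|Q|) ∫_Q |f - f_Q|`, valued in `ℝ≥0∞`. -/
def bmoNorm {n : ℕ} (f : (Fin n → ℝ) → ℝ) : ℝ≥0∞ :=
  ⨆ (a : Fin n → ℝ) (h : ℝ) (_ : 0 < h),
    (∫⁻ x in Cube a h, ENNReal.ofReal |f x - cubeAvg a h f|) / volume (Cube a h)

/-- The generalized weighted BMO norm `‖f‖_{BMO_{v,Y}} = sup_Q (1/Y(Q)) ∫_Q |f - f_Q| v`. -/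
def bmoVY {n : ℕ} (v : (Fin n → ℝ) → ℝ) (Y : (Fin n → ℝ) → ℝ → ℝ≥0∞)
    (f : (Fin n → ℝ) → ℝ) : ℝ≥0∞ :=
  ⨆ (a : Fin n → ℝ) (h : ℝ) (_ : 0 < h),
    (∫⁻ x in Cube a h, ENNReal.ofReal (|f x - cubeAvg a h f| * v x)) / Y a h

/-- `w(Q) = ∫_Q w` for a cube `Q`. -/
def wInt {n : ℕ} (w : (Fin n → ℝ) → ℝ) (a : Fin n → ℝ) (h : ℝ) : ℝ≥0∞ :=
  ∫⁻ x in Cube a h, ENNReal.ofReal (w x)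

/-- `w(2Q) = ∫_{2Q} w` for a cube `Q`. -/
def wInt2 {n : ℕ} (w : (Fin n → ℝ) → ℝ) (a : Fin n → ℝ) (h : ℝ) : ℝ≥0∞ :=
  ∫⁻ x in Cube2 a h, ENNReal.ofReal (w x)

/-- The generalized Fujii–Wilson constant `[v]_{A_{∞,Y}} = sup_Q (1/Y(Q)) ∫_Q M(v χ_Q)`. -/
def fwY {n : ℕ} (v : (Fin n → ℝ) → ℝ) (Y : (Fin n → ℝ) → ℝ → ℝ≥0∞) : ℝ≥0∞ :=
  ⨆ (a : Fin n → ℝ) (h : ℝ) (_ : 0 < h),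
    (∫⁻ x in Cube a h, maxFn ((Cube a h).indicator v) x) / Y a h

/-- The Fujii–Wilson `A∞` constant `[w]_{A∞} = sup_Q (1/w(Q)) ∫_Q M(w χ_Q)`. -/
def fwConst {n : ℕ} (w : (Fin n → ℝ) → ℝ) : ℝ≥0∞ :=
  ⨆ (a : Fin n → ℝ) (h : ℝ) (_ : 0 < h),
    (∫⁻ x in Cube a h, maxFn ((Cube a h).indicator w) x) / wInt w a h

/-- The weak Fujii–Wilson constant `[w]^{weak}_{A∞} = sup_Q (1/w(2Q)) ∫_Q M(w χ_Q)`. -/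
def fwWeak {n : ℕ} (w : (Fin n → ℝ) → ℝ) : ℝ≥0∞ :=
  ⨆ (a : Fin n → ℝ) (h : ℝ) (_ : 0 < h),
    (∫⁻ x in Cube a h, maxFn ((Cube a h).indicator w) x) / wInt2 w a h

/-- The `C_p` normalizing functional `Y(Q) = ∫_{ℝⁿ} M(χ_Q)^p w`. -/
def cpY {n : ℕ} (p : ℝ) (w : (Fin n → ℝ) → ℝ) (a : Fin n → ℝ) (h : ℝ) : ℝ≥0∞ :=
  ∫⁻ x, (maxFn ((Cube a h).indicator fun _ => (1 : ℝ)) x) ^ p * ENNReal.ofReal (w x)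

/-- The `C_p` Fujii–Wilson-type constant `[w]_{C_p}`. -/
def cpConst {n : ℕ} (p : ℝ) (w : (Fin n → ℝ) → ℝ) : ℝ≥0∞ :=
  ⨆ (a : Fin n → ℝ) (h : ℝ) (_ : 0 < h),
    (∫⁻ x in Cube a h, maxFn ((Cube a h).indicator w) x) / cpY p w a h

/-- The `A_p` constant `[w]_{A_p}` for `1 < p < ∞`. -/
def apConst {n : ℕ} (p : ℝ) (w : (Fin n → ℝ) → ℝ) : ℝ≥0∞ :=
  ⨆ (a : Fin n → ℝ) (h : ℝ) (_ : 0 < h),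
    (wInt w a h / volume (Cube a h)) *
      ((∫⁻ x in Cube a h, ENNReal.ofReal (w x) ^ (1 - p / (p - 1))) / volume (Cube a h)) ^ (p - 1)

/-- A weight: a nonnegative locally integrable function on `ℝⁿ`. -/
def IsWeight {n : ℕ} (v : (Fin n → ℝ) → ℝ) : Prop :=
  (∀ x, 0 ≤ v x) ∧ LocallyIntegrable v volume

/-- A cube functional `Y : 𝒬 → (0,∞)`: positive finite values on cubes. -/
def IsCubeFunctional {n : ℕ} (Y : (Fin n → ℝ) → ℝ → ℝ≥0∞) : Prop :=
  ∀ (a : Fin n → ℝ) (h : ℝ), 0 < h → 0 < Y a h ∧ Y a h < ⊤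

/-- Membership in the class `𝒴_q` with constant `β`: for every cube `Q`, every `L ≥ 1`
and every `L`-small family of pairwise non-overlapping subcubes of `Q`,
`∑_{P ∈ Λ} Y(P) ≤ β Y(Q) L^{-1/q}`. -/
def MemY {n : ℕ} (q β : ℝ) (Y : (Fin n → ℝ) → ℝ → ℝ≥0∞) : Prop :=
  ∀ (a : Fin n → ℝ) (h : ℝ), 0 < h → ∀ L : ℝ, 1 ≤ L →
    ∀ Λ : Set ((Fin n → ℝ) × ℝ),
      (∀ p ∈ Λ, 0 < p.2 ∧ Cube p.1 p.2 ⊆ Cube a h) →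
      (Λ.Pairwise fun p r => Disjoint (interior (Cube p.1 p.2)) (interior (Cube r.1 r.2))) →
      (∑' p : Λ, volume (Cube p.1.1 p.1.2)) ≤ volume (Cube a h) / ENNReal.ofReal L →
      (∑' p : Λ, Y p.1.1 p.1.2) ≤ ENNReal.ofReal β * Y a h * ENNReal.ofReal (L ^ (-1 / q))

/-- The Luxemburg norm in the Orlicz space `exp L^β` with respect to the measure `μ`. -/
def expLuxNorm {X : Type*} [MeasurableSpace X] (μ : Measure X) (β : ℝ) (g : X → ℝ) : ℝ≥0∞ :=
  ⨅ (lam : ℝ) (_ : 0 < lam)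
    (_ : ∫⁻ x, ENNReal.ofReal (Real.exp ((|g x| / lam) ^ β) - 1) ∂μ ≤ 1), ENNReal.ofReal lam

/-- The weighted measure `w dx` restricted to a set `Q`. -/
def wMeasureOn {n : ℕ} (w : (Fin n → ℝ) → ℝ) (Q : Set (Fin n → ℝ)) : Measure (Fin n → ℝ) :=
  (volume.restrict Q).withDensity fun x => ENNReal.ofReal (w x)

/-- The dyadic grid `𝒟(Q)` relative to the cube with lower corner `a₀` and side `h₀`:
parameters of all dyadic subcubes of `Q`. -/
def dyadicOf {n : ℕ} (a₀ : Fin n → ℝ) (h₀ : ℝ) : Set ((Fin n → ℝ) × ℝ) :=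
  {p | ∃ (k : ℕ) (m : Fin n → ℕ), (∀ i, m i < 2 ^ k) ∧
    p.2 = h₀ / 2 ^ k ∧ p.1 = fun i => a₀ i + (m i : ℝ) * (h₀ / 2 ^ k)}

/-- The functional `w_r(Q) = |Q| ((1/|Q|) ∫_Q w^r)^{1/r}`. -/
def wrY {n : ℕ} (w : (Fin n → ℝ) → ℝ) (r : ℝ) (a : Fin n → ℝ) (h : ℝ) : ℝ≥0∞ :=
  volume (Cube a h) *
    ((∫⁻ x in Cube a h, ENNReal.ofReal (w x) ^ r) / volume (Cube a h)) ^ (1 / r)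

theorem cube_eq_Icc {n : ℕ} (a : Fin n → ℝ) (h : ℝ) :
    Cube a h = Set.Icc a (fun i => a i + h) := by
  rw [Cube, Set.pi_univ_Icc]

theorem cube_eq_closedBall {n : ℕ} (a : Fin n → ℝ) {h : ℝ} (hh : 0 < h) :
    Cube a h = Metric.closedBall (fun i => a i + h / 2) (h / 2) := by
  rw [closedBall_pi _ (by positivity), Cube]
  congr 1
  ext i x
  rw [Real.closedBall_eq_Icc, add_sub_cancel_right, add_assoc, add_halves]

theorem measurableSet_cube {n : ℕ} (a : Fin n → ℝ) (h : ℝ) : MeasurableSet (Cube a h) := by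
  rw [cube_eq_Icc]; exact measurableSet_Icc

theorem isCompact_cube {n : ℕ} (a : Fin n → ℝ) (h : ℝ) : IsCompact (Cube a h) := by
  rw [cube_eq_Icc]; exact isCompact_Icc

theorem volume_cube {n : ℕ} (a : Fin n → ℝ) (h : ℝ) :
    volume (Cube a h) = ENNReal.ofReal h ^ n := by
  rw [cube_eq_Icc, Real.volume_Icc_pi]; simp

theorem volume_cube_ne_zero {n : ℕ} (a : Fin n → ℝ) {h : ℝ} (hh : 0 < h) :
    volume (Cube a h) ≠ 0 := by
  rw [volume_cube]; exact pow_ne_zero _ (by simpa using hh)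

theorem volume_cube_ne_top {n : ℕ} (a : Fin n → ℝ) (h : ℝ) : volume (Cube a h) ≠ ⊤ :=
  (isCompact_cube a h).measure_ne_top

/-- The index of the half-open dyadic cell of generation `k`, relative to the cube with lower
corner `a` and side `h`, that contains `x`. -/
def dyadicIndex {n : ℕ} (a : Fin n → ℝ) (h : ℝ) (k : ℕ) (x : Fin n → ℝ) : Fin n → ℤ :=
  fun i => ⌊(x i - a i) / h * 2 ^ k⌋

/-- The half-open dyadic cell of generation `k` and index `m`. -/
def dyadicCell {n : ℕ} (a : Fin n → ℝ) (h : ℝ) (k : ℕ) (m : Fin n → ℤ) : Set (Fin n → ℝ) :=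
  {x | dyadicIndex a h k x = m}

/-- The lower corner of a dyadic cell. -/
def dyadicCorner {n : ℕ} (a : Fin n → ℝ) (h : ℝ) (k : ℕ) (m : Fin n → ℤ) : Fin n → ℝ :=
  fun i => a i + m i * (h / 2 ^ k)

theorem dyadicCell_eq_pi {n : ℕ} (a : Fin n → ℝ) {h : ℝ} (hh : 0 < h) (k : ℕ) (m : Fin n → ℤ) :
    dyadicCell a h k m = Set.univ.pi fun i =>
      Set.Ico (dyadicCorner a h k m i) (dyadicCorner a h k m i + h / 2 ^ k) := by
  ext x
  simp only [dyadicCell, dyadicIndex, dyadicCorner, mem_ofPred_eq, mem_univ_pi, mem_Ico,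
    funext_iff, Int.floor_eq_iff]
  refine forall_congr' fun i => ?_
  have h2 : (0 : ℝ) < 2 ^ k := by positivity
  have e : (x i - a i) / h * 2 ^ k = (x i - a i) / (h / 2 ^ k) := by field_simp
  rw [e, le_div_iff₀ (by positivity), div_lt_iff₀ (by positivity)]
  constructor <;> rintro ⟨h1, h2⟩ <;> constructor <;> linarith

theorem dyadicCell_ae_eq {n : ℕ} (a : Fin n → ℝ) {h : ℝ} (hh : 0 < h) (k : ℕ) (m : Fin n → ℤ) :
    dyadicCell a h k m =ᵐ[volume] Cube (dyadicCorner a h k m) (h / 2 ^ k) := by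
  rw [dyadicCell_eq_pi a hh, cube_eq_Icc]
  exact Measure.univ_pi_Ico_ae_eq_Icc

theorem measurableSet_dyadicCell {n : ℕ} (a : Fin n → ℝ) {h : ℝ} (hh : 0 < h) (k : ℕ)
    (m : Fin n → ℤ) : MeasurableSet (dyadicCell a h k m) := by
  rw [dyadicCell_eq_pi a hh]
  exact MeasurableSet.univ_pi fun i => measurableSet_Ico

theorem volume_dyadicCell {n : ℕ} (a : Fin n → ℝ) {h : ℝ} (hh : 0 < h) (k : ℕ) (m : Fin n → ℤ) :
    volume (dyadicCell a h k m) = ENNReal.ofReal (h / 2 ^ k) ^ n := by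
  rw [measure_congr (dyadicCell_ae_eq a hh k m), volume_cube]

theorem volume_dyadicCell_succ {n : ℕ} (a : Fin n → ℝ) {h : ℝ} (hh : 0 < h) (k : ℕ)
    (m m' : Fin n → ℤ) :
    volume (dyadicCell a h k m) = 2 ^ n * volume (dyadicCell a h (k + 1) m') := by
  rw [volume_dyadicCell a hh, volume_dyadicCell a hh, ← mul_pow]
  congr 1
  rw [← ENNReal.ofReal_ofNat 2, ← ENNReal.ofReal_mul (by norm_num)]
  congr 1
  field_simp
  ring

theorem dyadicIndex_succ_div {n : ℕ} (a : Fin n → ℝ) (h : ℝ) (k : ℕ) (x : Fin n → ℝ) :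
    (fun i => dyadicIndex a h (k + 1) x i / 2) = dyadicIndex a h k x := by
  ext i
  have := Int.mul_natCast_floor_div_cancel (n := 2) two_ne_zero ((x i - a i) / h * 2 ^ k)
  simp only [dyadicIndex]
  rw [pow_succ, ← mul_assoc]
  exact_mod_cast this

theorem dyadicIndex_eq_of_le {n : ℕ} (a : Fin n → ℝ) (h : ℝ) {k l : ℕ} (hkl : k ≤ l)
    {x y : Fin n → ℝ} (hxy : dyadicIndex a h l x = dyadicIndex a h l y) :
    dyadicIndex a h k x = dyadicIndex a h k y := by
  induction l, hkl using Nat.le_induction with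
  | base => exact hxy
  | succ l _ ih =>
    apply ih
    rw [← dyadicIndex_succ_div, hxy, dyadicIndex_succ_div]

theorem dyadicCell_zero_ae_eq {n : ℕ} (a : Fin n → ℝ) {h : ℝ} (hh : 0 < h) :
    dyadicCell a h 0 0 =ᵐ[volume] Cube a h := by
  have := dyadicCell_ae_eq a hh 0 0
  have e : dyadicCorner a h 0 0 = a := by ext i; simp [dyadicCorner]
  rwa [e, pow_zero, div_one] at this

theorem cube_dyadicCorner_subset {n : ℕ} (a : Fin n → ℝ) {h : ℝ} (hh : 0 < h) (k : ℕ)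
    {x : Fin n → ℝ} (hx : dyadicIndex a h 0 x = 0) :
    Cube (dyadicCorner a h k (dyadicIndex a h k x)) (h / 2 ^ k) ⊆ Cube a h := by
  intro y hy i hi
  have hy := hy i hi
  have hxi := congrFun hx i
  simp only [dyadicIndex, pow_zero, mul_one, Pi.zero_apply, Int.floor_eq_zero_iff, mem_Ico] at hxi
  simp only [dyadicCorner, dyadicIndex, mem_Icc] at hy ⊢
  set z := (x i - a i) / h
  have h0 : (0 : ℤ) ≤ ⌊z * 2 ^ k⌋ := Int.floor_nonneg.2 (by have := hxi.1; positivity)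
  have h1 : ⌊z * 2 ^ k⌋ < (2 ^ k : ℤ) := by
    rw [Int.floor_lt]; push_cast
    have : (0 : ℝ) < 2 ^ k := by positivity
    nlinarith [hxi.2]
  have h0' : (0 : ℝ) ≤ ⌊z * 2 ^ k⌋ := by exact_mod_cast h0
  have h1' : (⌊z * 2 ^ k⌋ : ℝ) + 1 ≤ 2 ^ k := by exact_mod_cast h1
  have hs : 0 < h / 2 ^ k := by positivity
  have hm : (2 : ℝ) ^ k * (h / 2 ^ k) = h := by field_simp
  constructor
  · nlinarith [hy.1, mul_nonneg h0' hs.le]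
  · nlinarith [hy.2, mul_le_mul_of_nonneg_right h1' hs.le]

theorem ofReal_setAverage_abs {n : ℕ} {f : (Fin n → ℝ) → ℝ} (hf : LocallyIntegrable f volume)
    (a : Fin n → ℝ) {h : ℝ} (hh : 0 < h) :
    ENNReal.ofReal (⨍ x in Cube a h, |f x|) * volume (Cube a h) =
      ∫⁻ x in Cube a h, ENNReal.ofReal |f x| := by
  have hfi : IntegrableOn f (Cube a h) := hf.integrableOn_isCompact (isCompact_cube a h)
  have hv0 := volume_cube_ne_zero a hh
  have hvt := volume_cube_ne_top a h
  rw [setAverage_eq, smul_eq_mul, ENNReal.ofReal_mul (by positivity), measureReal_def,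
    ← ofReal_integral_eq_lintegral_ofReal hfi.abs (ae_of_all _ fun _ => abs_nonneg _),
    ENNReal.ofReal_inv_of_pos (ENNReal.toReal_pos hv0 hvt), ENNReal.ofReal_toReal hvt, mul_right_comm,
    ENNReal.inv_mul_cancel hv0 hvt, one_mul]

theorem ae_tendsto_dyadic_average {n : ℕ} {f : (Fin n → ℝ) → ℝ}
    (hf : LocallyIntegrable f volume) (a : Fin n → ℝ) {h : ℝ} (hh : 0 < h) :
    ∀ᵐ x ∂(volume : Measure (Fin n → ℝ)), Filter.Tendsto
      (fun k => ⨍ y in Cube (dyadicCorner a h k (dyadicIndex a h k x)) (h / 2 ^ k), |f y|)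
      Filter.atTop (nhds |f x|) := by
  have hf' : LocallyIntegrable (fun x => |f x|) volume :=
    fun x => (hf x).norm
  filter_upwards [IsUnifLocDoublingMeasure.ae_tendsto_average volume hf' 1] with x hx
  have key := hx (l := Filter.atTop)
    (fun k i => dyadicCorner a h k (dyadicIndex a h k x) i + h / 2 ^ k / 2)
    (fun k : ℕ => h / 2 ^ k / 2) ?_ ?_
  · refine key.congr fun k => ?_
    rw [cube_eq_closedBall _ (by positivity)]
  · rw [tendsto_nhdsWithin_iff]
    refine ⟨?_, Filter.Eventually.of_forall fun k => by simp only [mem_Ioi]; positivity⟩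
    have := (tendsto_pow_atTop_nhds_zero_of_lt_one (r := (1 / 2 : ℝ)) (by norm_num)
      (by norm_num)).const_mul (h / 2)
    rw [mul_zero] at this
    refine this.congr fun k => ?_
    rw [one_div, inv_pow]; field_simp
  · refine Filter.Eventually.of_forall fun k => ?_
    rw [one_mul, ← cube_eq_closedBall _ (by positivity)]
    have : x ∈ dyadicCell a h k (dyadicIndex a h k x) := rfl
    rw [dyadicCell_eq_pi a hh] at this
    exact fun i hi => Ico_subset_Icc_self (this i hi)

/-- One step of the Calderón–Zygmund decomposition of `f` on a cube. -/
theorem exists_calderonZygmund {n : ℕ} {f : (Fin n → ℝ) → ℝ} (hf : LocallyIntegrable f volume)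
    (a : Fin n → ℝ) {h : ℝ} (hh : 0 < h) {t : ℝ} (ht : 0 < t)
    (hft : ∫⁻ x in Cube a h, ENNReal.ofReal |f x| ≤ ENNReal.ofReal t * volume (Cube a h)) :
    ∃ (S : Set (ℕ × (Fin n → ℤ))) (α : S → Fin n → ℝ) (η : S → ℝ), (∀ i, 0 < η i) ∧
      (∀ i, Cube (α i) (η i) ⊆ Cube a h) ∧
      Pairwise (Function.onFun (AEDisjoint volume) fun i => Cube (α i) (η i)) ∧
      2 * ∑' i, volume (Cube (α i) (η i)) ≤ volume (Cube a h) ∧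
      (∀ i, ∫⁻ x in Cube (α i) (η i), ENNReal.ofReal |f x| ≤
        ENNReal.ofReal (2 ^ (n + 1) * t) * volume (Cube (α i) (η i))) ∧
      ∀ᵐ x ∂volume.restrict (Cube a h \ ⋃ i, Cube (α i) (η i)), |f x| ≤ 2 * t := by
  classical
  let bad : ℕ → (Fin n → ℤ) → Prop := fun k m =>
    ENNReal.ofReal (2 * t) * volume (dyadicCell a h k m) <
      ∫⁻ x in dyadicCell a h k m, ENNReal.ofReal |f x|
  let S : Set (ℕ × (Fin n → ℤ)) := {p | ∃ x, dyadicIndex a h 0 x = 0 ∧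
    dyadicIndex a h p.1 x = p.2 ∧ bad p.1 p.2 ∧ ∀ j < p.1, ¬ bad j (dyadicIndex a h j x)}
  let cell : S → Set (Fin n → ℝ) := fun p => dyadicCell a h p.1.1 p.1.2
  have hcell : ∀ p : S, cell p =ᵐ[volume] Cube (dyadicCorner a h p.1.1 p.1.2) (h / 2 ^ p.1.1) :=
    fun p => dyadicCell_ae_eq a hh _ _
  have hbad0 : ¬ bad 0 0 := by
    simp only [bad, not_lt]
    rw [Measure.restrict_congr_set (dyadicCell_zero_ae_eq a hh),
      measure_congr (dyadicCell_zero_ae_eq a hh)]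
    refine hft.trans ?_
    gcongr
    linarith
  have hdisj : Pairwise (Function.onFun Disjoint cell) := by
    have aux : ∀ p q : S, p.1.1 ≤ q.1.1 → ∀ x ∈ cell p, x ∈ cell q → p = q := by
      rintro ⟨⟨k, m⟩, hp⟩ ⟨⟨l, m'⟩, hq⟩ hkl x hxp hxq
      simp only [cell, dyadicCell, mem_ofPred_eq] at hkl hxp hxq
      rcases hkl.eq_or_lt with rfl | hlt
      · simp only [Subtype.mk.injEq, Prod.mk.injEq, true_and]
        exact hxp.symm.trans hxq
      · obtain ⟨y, -, hy, -, hy'⟩ := hq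
        obtain ⟨-, -, -, hb, -⟩ := hp
        exact absurd (by
          rw [dyadicIndex_eq_of_le a h hkl (hy.trans hxq.symm), hxp]; exact hb) (hy' k hlt)
    intro p q hpq
    refine Set.disjoint_left.2 fun x hxp hxq => hpq ?_
    rcases le_total p.1.1 q.1.1 with hle | hle
    · exact aux p q hle x hxp hxq
    · exact (aux q p hle x hxq hxp).symm
  have hmeas : ∀ p, MeasurableSet (cell p) := fun p => measurableSet_dyadicCell a hh _ _
  have hsub : ∀ p : S, Cube (dyadicCorner a h p.1.1 p.1.2) (h / 2 ^ p.1.1) ⊆ Cube a h := by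
    rintro ⟨⟨k, m⟩, x, hx0, hx, -⟩
    simp only at hx ⊢
    rw [← hx]
    exact cube_dyadicCorner_subset a hh k hx0
  refine ⟨S, fun p => dyadicCorner a h p.1.1 p.1.2, fun p => h / 2 ^ p.1.1,
    fun p => by positivity, hsub, ?_, ?_, ?_, ?_⟩
  · intro p q hpq
    exact (hdisj hpq).aedisjoint.congr (hcell p).symm (hcell q).symm
  · have h2t : ENNReal.ofReal t ≠ 0 := by simpa using ht
    have h1 : ENNReal.ofReal (2 * t) * ∑' p, volume (cell p) ≤
        ENNReal.ofReal t * volume (Cube a h) := by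
      rw [← ENNReal.tsum_mul_left]
      calc ∑' p, ENNReal.ofReal (2 * t) * volume (cell p)
          ≤ ∑' p, ∫⁻ x in cell p, ENNReal.ofReal |f x| := by
            refine ENNReal.tsum_le_tsum fun p => ?_
            obtain ⟨x, -, -, hb, -⟩ := p.2
            exact hb.le
        _ = ∫⁻ x in ⋃ p, cell p, ENNReal.ofReal |f x| := by
            rw [lintegral_iUnion hmeas hdisj]
        _ ≤ ∫⁻ x in Cube a h, ENNReal.ofReal |f x| := by
            refine lintegral_mono' (Measure.restrict_mono_ae ?_) le_rfl
            have : (⋃ p, cell p) =ᵐ[volume]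
                ⋃ p : S, Cube (dyadicCorner a h p.1.1 p.1.2) (h / 2 ^ p.1.1) :=
              Filter.EventuallyEq.countable_iUnion hcell
            exact this.le.trans (LE.le.eventuallyLE (iUnion_subset hsub))
        _ ≤ _ := hft
    rw [ENNReal.ofReal_mul (by norm_num), ENNReal.ofReal_ofNat, mul_comm 2, mul_assoc,
      ENNReal.mul_le_mul_iff_right h2t ENNReal.ofReal_ne_top] at h1
    convert h1 using 4 with p
    exact (measure_congr (hcell p)).symm
  · rintro ⟨⟨k, m⟩, x, hx0, hx, hb, hmin⟩
    simp only at hx hb hmin ⊢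
    rw [← Measure.restrict_congr_set (dyadicCell_ae_eq a hh k m),
      ← measure_congr (dyadicCell_ae_eq a hh k m)]
    rcases k with _ | k
    · exact absurd (by rw [← hx, hx0] at hb; exact hb) hbad0
    · have h1 := not_lt.1 (hmin k (Nat.lt_succ_self k))
      have hsubc : dyadicCell a h (k + 1) m ⊆ dyadicCell a h k (dyadicIndex a h k x) := by
        intro y hy
        exact dyadicIndex_eq_of_le a h (Nat.le_succ k) (Eq.trans hy hx.symm)
      refine (lintegral_mono_set hsubc).trans (h1.trans (le_of_eq ?_))
      rw [volume_dyadicCell_succ a hh k _ m, ← mul_assoc]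
      congr 1
      rw [show (2 : ℝ) ^ (n + 1) * t = (2 * t) * 2 ^ n by ring,
        ENNReal.ofReal_mul (p := 2 * t) (by positivity), ENNReal.ofReal_pow (by norm_num),
        ENNReal.ofReal_ofNat]
  · have hU : (⋃ p, cell p) =ᵐ[volume]
        ⋃ p : S, Cube (dyadicCorner a h p.1.1 p.1.2) (h / 2 ^ p.1.1) :=
      Filter.EventuallyEq.countable_iUnion hcell
    have hE := (dyadicCell_zero_ae_eq a hh).diff hU
    rw [← Measure.restrict_congr_set hE, ae_restrict_iff' ((measurableSet_dyadicCell a hh _ _).diff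
      (MeasurableSet.iUnion hmeas))]
    filter_upwards [ae_tendsto_dyadic_average hf a hh] with x hx hxE
    refine le_of_tendsto' hx fun k => ?_
    have hnb : ∀ k, ¬ bad k (dyadicIndex a h k x) := by
      by_contra! hcon
      have hx' := hxE.2
      rw [mem_iUnion] at hx'
      exact hx' ⟨⟨(Nat.find hcon, dyadicIndex a h (Nat.find hcon) x), x, hxE.1, rfl,
        Nat.find_spec hcon, fun j hj => Nat.find_min hcon hj⟩, rfl⟩
    have h1 := not_lt.1 (hnb k)
    have hk : 0 < h / 2 ^ k := by positivity
    rw [Measure.restrict_congr_set (dyadicCell_ae_eq a hh _ _),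
      measure_congr (dyadicCell_ae_eq a hh _ _), ← ofReal_setAverage_abs hf _ hk,
      ENNReal.mul_le_mul_iff_left (volume_cube_ne_zero _ hk) (volume_cube_ne_top _ _),
      ENNReal.ofReal_le_ofReal_iff (by positivity)] at h1
    exact h1

theorem abs_cubeAvg_sub_le {n : ℕ} {b : (Fin n → ℝ) → ℝ} (hb : LocallyIntegrable b volume)
    (a : Fin n → ℝ) {h : ℝ} (hh : 0 < h) {c s : ℝ} (hs : 0 ≤ s)
    (hbs : ∫⁻ x in Cube a h, ENNReal.ofReal |b x - c| ≤ ENNReal.ofReal s * volume (Cube a h)) :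
    |cubeAvg a h b - c| ≤ s := by
  have hg : LocallyIntegrable (fun x => b x - c) volume := hb.sub (locallyIntegrable_const c)
  rw [← ofReal_setAverage_abs hg a hh, ENNReal.mul_le_mul_iff_left (volume_cube_ne_zero _ hh)
    (volume_cube_ne_top _ _), ENNReal.ofReal_le_ofReal_iff hs] at hbs
  refine le_trans ?_ hbs
  have hbi : IntegrableOn b (Cube a h) := hb.integrableOn_isCompact (isCompact_cube a h)
  have hv : 0 < volume.real (Cube a h) :=
    ENNReal.toReal_pos (volume_cube_ne_zero a hh) (volume_cube_ne_top a h)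
  have hc : IntegrableOn (fun _ : Fin n → ℝ => c) (Cube a h) :=
    integrableOn_const (volume_cube_ne_top a h)
  have e : cubeAvg a h b - c = ⨍ x in Cube a h, (b x - c) := by
    rw [cubeAvg, setAverage_eq, setAverage_eq, integral_sub hbi hc, setIntegral_const,
      smul_sub, smul_smul, inv_mul_cancel₀ hv.ne', one_smul]
  rw [e, setAverage_eq, setAverage_eq, smul_eq_mul, smul_eq_mul, abs_mul,
    abs_of_pos (inv_pos.2 hv)]
  gcongr
  exact abs_integral_le_integral_abs

/-- The average of a weight over a cube, as a real number. -/
def weightAvg {n : ℕ} (w : (Fin n → ℝ) → ℝ) (a : Fin n → ℝ) (h : ℝ) : ℝ :=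
  (wInt w a h / volume (Cube a h)).toReal

theorem wInt_ne_top {n : ℕ} {w : (Fin n → ℝ) → ℝ} (hw : IsWeight w) (a : Fin n → ℝ) (h : ℝ) :
    wInt w a h ≠ ⊤ :=
  (hw.2.integrableOn_isCompact (isCompact_cube a h)).lintegral_lt_top.ne

theorem wInt_ne_zero {n : ℕ} {w : (Fin n → ℝ) → ℝ} (hw : IsWeight w)
    (hpos : ∀ᵐ x ∂(volume : Measure (Fin n → ℝ)), 0 < w x) (a : Fin n → ℝ) {h : ℝ} (hh : 0 < h) :
    wInt w a h ≠ 0 := by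
  intro h0
  rw [wInt, lintegral_eq_zero_iff' hw.2.aestronglyMeasurable.aemeasurable.ennreal_ofReal.restrict]
    at h0
  have hF : ∀ᵐ x ∂(volume.restrict (Cube a h)), False := by
    filter_upwards [h0, ae_restrict_of_ae hpos] with x h1 h2
    simp only [Pi.zero_apply, ENNReal.ofReal_eq_zero] at h1
    linarith
  rw [ae_iff] at hF
  simp only [not_false_eq_true, Set.ofPred_true, Measure.restrict_apply_univ] at hF
  exact volume_cube_ne_zero a hh hF

theorem ofReal_weightAvg {n : ℕ} {w : (Fin n → ℝ) → ℝ} (hw : IsWeight w) (a : Fin n → ℝ) {h : ℝ}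
    (hh : 0 < h) : ENNReal.ofReal (weightAvg w a h) = wInt w a h / volume (Cube a h) :=
  ENNReal.ofReal_toReal (ENNReal.div_ne_top (wInt_ne_top hw a h) (volume_cube_ne_zero a hh))

theorem ofReal_weightAvg_mul {n : ℕ} {w : (Fin n → ℝ) → ℝ} (hw : IsWeight w) (a : Fin n → ℝ)
    {h : ℝ} (hh : 0 < h) :
    ENNReal.ofReal (weightAvg w a h) * volume (Cube a h) = wInt w a h := by
  rw [ofReal_weightAvg hw a hh,
    ENNReal.div_mul_cancel (volume_cube_ne_zero a hh) (volume_cube_ne_top a h)]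

theorem weightAvg_pos {n : ℕ} {w : (Fin n → ℝ) → ℝ} (hw : IsWeight w)
    (hpos : ∀ᵐ x ∂(volume : Measure (Fin n → ℝ)), 0 < w x) (a : Fin n → ℝ) {h : ℝ} (hh : 0 < h) :
    0 < weightAvg w a h :=
  ENNReal.toReal_pos
    (ENNReal.div_ne_zero.2 ⟨wInt_ne_zero hw hpos a hh, volume_cube_ne_top a h⟩)
    (ENNReal.div_ne_top (wInt_ne_top hw a h) (volume_cube_ne_zero a hh))

theorem weightAvg_le_of_maxFn_le {n : ℕ} {w : (Fin n → ℝ) → ℝ} (hw : IsWeight w) {A : ℝ}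
    (hA : 0 ≤ A) {x : Fin n → ℝ} (hx : maxFn w x ≤ ENNReal.ofReal A * ENNReal.ofReal (w x))
    {a : Fin n → ℝ} {h : ℝ} (hh : 0 < h) (hxQ : x ∈ Cube a h) :
    weightAvg w a h ≤ A * w x := by
  rw [← ENNReal.ofReal_le_ofReal_iff (mul_nonneg hA (hw.1 x)), ofReal_weightAvg hw a hh,
    ENNReal.ofReal_mul hA]
  refine le_trans ?_ hx
  have e : wInt w a h = ∫⁻ y in Cube a h, ENNReal.ofReal |w y| := by
    simp only [wInt, abs_of_nonneg (hw.1 _)]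
  rw [e]
  exact le_iSup₂_of_le a h (le_iSup₂_of_le hh hxQ le_rfl)

/-- The oscillation of `b` about its average on a cube, relative to the weight `w` and a
scale `lam`. -/
def relOsc {n : ℕ} (w b : (Fin n → ℝ) → ℝ) (lam : ℝ) (a : Fin n → ℝ) (h : ℝ)
    (x : Fin n → ℝ) : ℝ :=
  |b x - cubeAvg a h b| / (lam * w x)

/-- A countable non-overlapping family of subcubes of a cube, of at most half its measure. -/
structure IsHalfFamily {n : ℕ} (a : Fin n → ℝ) (h : ℝ) {ι : Type} (α : ι → Fin n → ℝ)
    (η : ι → ℝ) : Prop where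
  pos : ∀ i, 0 < η i
  subset : ∀ i, Cube (α i) (η i) ⊆ Cube a h
  disjoint : Pairwise (Function.onFun (AEDisjoint volume) fun i => Cube (α i) (η i))
  volume_le : 2 * ∑' i, volume (Cube (α i) (η i)) ≤ volume (Cube a h)

theorem IsHalfFamily.lintegral_eq {n : ℕ} {a : Fin n → ℝ} {h : ℝ} {ι : Type} [Countable ι]
    {α : ι → Fin n → ℝ} {η : ι → ℝ} (H : IsHalfFamily a h α η) (F : (Fin n → ℝ) → ℝ≥0∞) :
    ∫⁻ x in Cube a h, F x = (∫⁻ x in Cube a h \ ⋃ i, Cube (α i) (η i), F x) +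
      ∑' i, ∫⁻ x in Cube (α i) (η i), F x := by
  rw [← lintegral_iUnion₀ (fun i => (measurableSet_cube _ _).nullMeasurableSet) H.disjoint,
    add_comm, ← lintegral_inter_add_sdiff (B := ⋃ i, Cube (α i) (η i)) F (Cube a h)
      (MeasurableSet.iUnion fun i => measurableSet_cube _ _),
    Set.inter_eq_self_of_subset_right (iUnion_subset H.subset)]

theorem IsHalfFamily.volume_eq {n : ℕ} {a : Fin n → ℝ} {h : ℝ} {ι : Type} [Countable ι]
    {α : ι → Fin n → ℝ} {η : ι → ℝ} (H : IsHalfFamily a h α η) :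
    volume (Cube a h) = volume (Cube a h \ ⋃ i, Cube (α i) (η i)) +
      ∑' i, volume (Cube (α i) (η i)) := by
  simpa using H.lintegral_eq fun _ => 1

/-- `D` satisfies the one-step Calderón–Zygmund recursion with respect to the weight `w`. -/
def HasStep {n : ℕ} (w : (Fin n → ℝ) → ℝ) (A : ℝ) (D : (Fin n → ℝ) → ℝ → (Fin n → ℝ) → ℝ) :
    Prop :=
  ∀ (a : Fin n → ℝ) (h : ℝ), 0 < h → ∃ (ι : Type) (_ : Countable ι) (α : ι → Fin n → ℝ)
    (η : ι → ℝ), IsHalfFamily a h α η ∧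
      (∀ i, ∀ᵐ x ∂volume.restrict (Cube (α i) (η i)),
        D a h x ≤ D (α i) (η i) x + weightAvg w a h / (8 * A * w x)) ∧
      ∀ᵐ x ∂volume.restrict (Cube a h \ ⋃ i, Cube (α i) (η i)),
        D a h x ≤ weightAvg w a h / (8 * A * w x)

theorem hasStep_relOsc {n : ℕ} {w b : (Fin n → ℝ) → ℝ} (hw : IsWeight w)
    (hpos : ∀ᵐ x ∂(volume : Measure (Fin n → ℝ)), 0 < w x) (hb : LocallyIntegrable b volume)
    {A β : ℝ} (hA : 0 < A) (hβ : 0 < β)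
    (hB : ∀ (a : Fin n → ℝ) (h : ℝ), 0 < h →
      ∫⁻ x in Cube a h, ENNReal.ofReal |b x - cubeAvg a h b| ≤ ENNReal.ofReal β * wInt w a h) :
    HasStep w A (relOsc w b (2 ^ (n + 4) * A * β)) := by
  intro a h hh
  have hW := weightAvg_pos hw hpos a hh
  set W := weightAvg w a h with hWdef
  have hf : LocallyIntegrable (fun x => b x - cubeAvg a h b) volume :=
    hb.sub (locallyIntegrable_const _)
  obtain ⟨S, α, η, h1, h2, h3, h4, h5, h6⟩ := exists_calderonZygmund hf a hh
    (t := β * W) (by positivity) (by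
      rw [ENNReal.ofReal_mul hβ.le, mul_assoc, ofReal_weightAvg_mul hw a hh]
      exact hB a h hh)
  refine ⟨S, inferInstance, α, η, ⟨h1, h2, h3, h4⟩, fun i => ?_, ?_⟩
  · filter_upwards [ae_restrict_of_ae hpos] with x hx
    have h7 := abs_cubeAvg_sub_le hb (α i) (h1 i) (by positivity) (h5 i)
    have h8 : |b x - cubeAvg a h b| ≤
        |b x - cubeAvg (α i) (η i) b| + 2 ^ (n + 1) * (β * W) :=
      (abs_sub_le _ (cubeAvg (α i) (η i) b) _).trans (by gcongr)
    have e : W / (8 * A * w x) =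
        2 ^ (n + 1) * (β * W) / (2 ^ (n + 4) * A * β * w x) := by
      rw [pow_add, pow_add]; field_simp; norm_num
    rw [e, relOsc, relOsc, ← add_div]
    gcongr
  · filter_upwards [ae_restrict_of_ae hpos, h6] with x hx h8
    have h9 : (1 : ℝ) ≤ 2 ^ n := one_le_pow₀ (by norm_num)
    have h10 : |b x - cubeAvg a h b| ≤ 2 ^ (n + 1) * (β * W) := by
      refine h8.trans ?_
      have : 0 < β * W := by positivity
      rw [pow_succ]; nlinarith
    have e : W / (8 * A * w x) =
        2 ^ (n + 1) * (β * W) / (2 ^ (n + 4) * A * β * w x) := by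
      rw [pow_add, pow_add]; field_simp; norm_num
    rw [e, relOsc]
    gcongr

/-- A self-improving family of finite bounds improves to the fixed point. -/
theorem le_ofReal_mul_of_bootstrap {ι : Type*} {F V : ι → ℝ≥0∞} (hV0 : ∀ i, V i ≠ 0)
    (hVt : ∀ i, V i ≠ ⊤) {C p q : ℝ} (hp : 0 ≤ p) (hq : q < 1)
    (hC : ∀ i, F i ≤ ENNReal.ofReal C * V i)
    (hstep : ∀ X : ℝ, 0 ≤ X → (∀ i, F i ≤ ENNReal.ofReal X * V i) →
      ∀ i, F i ≤ ENNReal.ofReal (p + q * X) * V i) (i : ι) :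
    F i ≤ ENNReal.ofReal (p / (1 - q)) * V i := by
  set s : ℝ≥0∞ := ⨆ i, F i / V i with hs
  have hst : s ≠ ⊤ := by
    refine ne_top_of_le_ne_top (ENNReal.ofReal_ne_top (r := C)) (iSup_le fun i => ?_)
    exact (ENNReal.div_le_iff (hV0 i) (hVt i)).2 (hC i)
  have hsF : ∀ i, F i ≤ ENNReal.ofReal s.toReal * V i := by
    intro i
    rw [ENNReal.ofReal_toReal hst, ← ENNReal.div_le_iff (hV0 i) (hVt i)]
    exact le_iSup (fun i => F i / V i) i
  have h1 : s ≤ ENNReal.ofReal (p + q * s.toReal) := by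
    refine iSup_le fun i => (ENNReal.div_le_iff (hV0 i) (hVt i)).2 ?_
    exact hstep _ ENNReal.toReal_nonneg hsF i
  have h2 : s.toReal ≤ p / (1 - q) := by
    rw [le_div_iff₀ (by linarith)]
    rcases le_total 0 (p + q * s.toReal) with h0 | h0
    · have := ENNReal.toReal_le_of_le_ofReal h0 h1
      linarith
    · rw [ENNReal.ofReal_of_nonpos h0] at h1
      have : s = 0 := le_antisymm h1 bot_le
      simp [this, hp]
  refine (hsF i).trans ?_
  gcongr

theorem exp_one_eighth_le : Real.exp (1 / 8) ≤ 4 / 3 := by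
  have h1 := Real.add_one_le_exp (-(1 / 8 : ℝ))
  rw [Real.exp_neg] at h1
  have h2 := Real.exp_pos (1 / 8)
  have h3 : (Real.exp (1 / 8))⁻¹ * Real.exp (1 / 8) = 1 := inv_mul_cancel₀ h2.ne'
  nlinarith

theorem exp_sub_one_le {s : ℝ} (hs : s ≤ 1 / 8) (hs0 : 0 ≤ s) : Real.exp s - 1 ≤ 4 / 3 * s := by
  have h1 := Real.add_one_le_exp (-s)
  have h2 := Real.exp_pos s
  have h3 : Real.exp (-s) * Real.exp s = 1 := by rw [← Real.exp_add]; simp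
  have h4 := (Real.exp_le_exp.2 hs).trans exp_one_eighth_le
  nlinarith

theorem exp_min_le {u v s m : ℝ} (huv : u ≤ v + s) (hs : 0 ≤ s) :
    Real.exp (min u m) ≤ Real.exp (min v m) * Real.exp s := by
  rw [← Real.exp_add, Real.exp_le_exp, ← min_add_add_right]
  exact min_le_min huv (by linarith)

section Recursion

variable {n : ℕ} {w : (Fin n → ℝ) → ℝ} {A : ℝ} {D : (Fin n → ℝ) → ℝ → (Fin n → ℝ) → ℝ}

theorem relWeight_le (hA : 0 < A) {W u : ℝ} (hu : 0 < u) (hWu : W ≤ A * u) :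
    W / (8 * A * u) ≤ 1 / 8 := by
  rw [div_le_iff₀ (by positivity)]
  linarith

theorem lintegral_exp_min_le (hw : IsWeight w)
    (hpos : ∀ᵐ x ∂(volume : Measure (Fin n → ℝ)), 0 < w x) (hA : 0 < A)
    (hM : ∀ᵐ x ∂(volume : Measure (Fin n → ℝ)),
      maxFn w x ≤ ENNReal.ofReal A * ENNReal.ofReal (w x))
    (hD : HasStep w A D) (m : ℕ) (a : Fin n → ℝ) {h : ℝ} (hh : 0 < h) :
    ∫⁻ x in Cube a h, ENNReal.ofReal (Real.exp (min (D a h x) m)) ≤ 4 * volume (Cube a h) := by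
  have key := le_ofReal_mul_of_bootstrap (ι := {p : (Fin n → ℝ) × ℝ // 0 < p.2})
    (F := fun p => ∫⁻ x in Cube p.1.1 p.1.2, ENNReal.ofReal (Real.exp (min (D p.1.1 p.1.2 x) m)))
    (V := fun p => volume (Cube p.1.1 p.1.2)) (fun p => volume_cube_ne_zero _ p.2)
    (fun p => volume_cube_ne_top _ _) (C := Real.exp m) (p := 4 / 3) (q := 2 / 3)
    (by norm_num) (by norm_num) ?_ ?_ ⟨(a, h), hh⟩
  · norm_num at key
    exact key
  · intro p
    rw [← setLIntegral_const]
    refine lintegral_mono fun x => ?_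
    gcongr
    exact min_le_right _ _
  · rintro X hX hXF ⟨⟨a, h⟩, hh⟩
    simp only at hh ⊢
    have hW := weightAvg_pos hw hpos a hh
    obtain ⟨ι, _, α, η, H, hR, hE⟩ := hD a h hh
    have h1 : ∫⁻ x in Cube a h \ ⋃ i, Cube (α i) (η i),
        ENNReal.ofReal (Real.exp (min (D a h x) m)) ≤
        ENNReal.ofReal (4 / 3) * volume (Cube a h \ ⋃ i, Cube (α i) (η i)) := by
      rw [← setLIntegral_const]
      refine lintegral_mono_ae ?_
      filter_upwards [hE, ae_restrict_of_ae hpos, ae_restrict_of_ae hM,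
        ae_restrict_mem ((measurableSet_cube a h).diff
          (MeasurableSet.iUnion fun i => measurableSet_cube (α i) (η i)))] with x hx hwx hMx hxE
      have hs := relWeight_le hA hwx (weightAvg_le_of_maxFn_le hw hA.le hMx hh hxE.1)
      refine ENNReal.ofReal_le_ofReal (le_trans ?_ exp_one_eighth_le)
      exact Real.exp_le_exp.2 ((min_le_left _ _).trans (hx.trans hs))
    have h2 : ∀ i, ∫⁻ x in Cube (α i) (η i), ENNReal.ofReal (Real.exp (min (D a h x) m)) ≤
        ENNReal.ofReal (4 / 3) * (ENNReal.ofReal X * volume (Cube (α i) (η i))) := by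
      intro i
      refine le_trans ?_ (mul_le_mul_right (hXF ⟨(α i, η i), H.pos i⟩) _)
      rw [← lintegral_const_mul' _ _ ENNReal.ofReal_ne_top]
      refine lintegral_mono_ae ?_
      filter_upwards [hR i, ae_restrict_of_ae hpos, ae_restrict_of_ae hM,
        ae_restrict_mem (measurableSet_cube (α i) (η i))] with x hx hwx hMx hxE
      have hs := relWeight_le hA hwx (weightAvg_le_of_maxFn_le hw hA.le hMx hh (H.subset i hxE))
      rw [← ENNReal.ofReal_mul (by norm_num), mul_comm]
      refine ENNReal.ofReal_le_ofReal ((exp_min_le hx (by positivity)).trans ?_)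
      gcongr
      exact (Real.exp_le_exp.2 hs).trans exp_one_eighth_le
    rw [H.lintegral_eq]
    refine (add_le_add h1 (ENNReal.tsum_le_tsum h2)).trans ?_
    rw [ENNReal.tsum_mul_left, ENNReal.tsum_mul_left, ← mul_add]
    have h3 : volume (Cube a h \ ⋃ i, Cube (α i) (η i)) ≤ volume (Cube a h) :=
      measure_mono Set.sdiff_subset
    have h4 : ∑' i, volume (Cube (α i) (η i)) ≤ ENNReal.ofReal (1 / 2) * volume (Cube a h) := by
      have := mul_le_mul_right H.volume_le (ENNReal.ofReal (1 / 2))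
      rwa [← mul_assoc, ← ENNReal.ofReal_ofNat 2, ← ENNReal.ofReal_mul (by norm_num),
        show (1 / 2 * 2 : ℝ) = 1 by norm_num, ENNReal.ofReal_one, one_mul] at this
    calc _ ≤ ENNReal.ofReal (4 / 3) * (volume (Cube a h) +
          ENNReal.ofReal X * (ENNReal.ofReal (1 / 2) * volume (Cube a h))) := by gcongr
      _ = ENNReal.ofReal (4 / 3 + 2 / 3 * X) * volume (Cube a h) := by
        rw [show 4 / 3 + 2 / 3 * X = 4 / 3 * (1 + X * (1 / 2)) by ring,
          ENNReal.ofReal_mul (by norm_num), ENNReal.ofReal_add (by norm_num) (by positivity),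
          ENNReal.ofReal_mul hX, ENNReal.ofReal_one]
        ring

theorem lintegral_exp_min_sub_one_le (hw : IsWeight w)
    (hpos : ∀ᵐ x ∂(volume : Measure (Fin n → ℝ)), 0 < w x) (hA : 0 < A)
    (hM : ∀ᵐ x ∂(volume : Measure (Fin n → ℝ)),
      maxFn w x ≤ ENNReal.ofReal A * ENNReal.ofReal (w x))
    (hDm : ∀ a h, AEMeasurable (D a h) volume)
    (hD : HasStep w A D) (m : ℕ) (a : Fin n → ℝ) {h : ℝ} (hh : 0 < h) :
    ∫⁻ x in Cube a h, ENNReal.ofReal (Real.exp (min (D a h x) m) - 1) * ENNReal.ofReal (w x) ≤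
      wInt w a h := by
  have key := le_ofReal_mul_of_bootstrap (ι := {p : (Fin n → ℝ) × ℝ // 0 < p.2})
    (F := fun p => ∫⁻ x in Cube p.1.1 p.1.2,
      ENNReal.ofReal (Real.exp (min (D p.1.1 p.1.2 x) m) - 1) * ENNReal.ofReal (w x))
    (V := fun p => wInt w p.1.1 p.1.2) (fun p => wInt_ne_zero hw hpos _ p.2)
    (fun p => wInt_ne_top hw _ _) (C := Real.exp m) (p := 5 / (12 * A)) (q := 1 - 1 / (2 * A))
    (by positivity) (by have : 0 < 1 / (2 * A) := by positivity
                        linarith) ?_ ?_ ⟨(a, h), hh⟩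
  · refine key.trans (mul_le_of_le_one_left' ?_)
    rw [show 5 / (12 * A) / (1 - (1 - 1 / (2 * A))) = 5 / 6 by field_simp; norm_num,
      ENNReal.ofReal_le_one]
    norm_num
  · intro p
    simp only [wInt]
    rw [← lintegral_const_mul' _ _ ENNReal.ofReal_ne_top]
    refine lintegral_mono fun x => ?_
    have h1 : Real.exp (min (D p.1.1 p.1.2 x) m) ≤ Real.exp m :=
      Real.exp_le_exp.2 (min_le_right _ _)
    gcongr
    linarith
  · rintro X hX hXF ⟨⟨a, h⟩, hh⟩
    simp only at hh ⊢
    have hW := weightAvg_pos hw hpos a hh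
    obtain ⟨ι, _, α, η, H, hR, hE⟩ := hD a h hh
    have hWV := ofReal_weightAvg_mul hw a hh
    set W := weightAvg w a h with hWdef
    set τ := W / (6 * A) with hτ
    have hτ0 : 0 < τ := by positivity
    set E := Cube a h \ ⋃ i, Cube (α i) (η i) with hEdef
    have hEm : MeasurableSet E := (measurableSet_cube a h).diff
      (MeasurableSet.iUnion fun i => measurableSet_cube (α i) (η i))
    have hsx : ∀ {x}, 0 < w x → W / (8 * A * w x) * (4 / 3) * w x = τ := by
      intro x hx
      rw [hτ]; field_simp; norm_num
    have h1 : ∫⁻ x in E,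
        ENNReal.ofReal (Real.exp (min (D a h x) m) - 1) * ENNReal.ofReal (w x) ≤
        ENNReal.ofReal τ * volume E := by
      rw [← setLIntegral_const]
      refine lintegral_mono_ae ?_
      filter_upwards [hE, ae_restrict_of_ae hpos, ae_restrict_of_ae hM,
        ae_restrict_mem hEm] with x hx hwx hMx hxE
      have hs := relWeight_le hA hwx (weightAvg_le_of_maxFn_le hw hA.le hMx hh hxE.1)
      rw [← ENNReal.ofReal_mul' hwx.le]
      refine ENNReal.ofReal_le_ofReal ?_
      have h3 : Real.exp (min (D a h x) m) ≤ Real.exp (W / (8 * A * w x)) :=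
        Real.exp_le_exp.2 ((min_le_left _ _).trans hx)
      have h4 := exp_sub_one_le hs (by positivity)
      rw [← hsx hwx]
      refine mul_le_mul_of_nonneg_right ?_ hwx.le
      linarith
    have h2 : ∀ i, ∫⁻ x in Cube (α i) (η i),
        ENNReal.ofReal (Real.exp (min (D a h x) m) - 1) * ENNReal.ofReal (w x) ≤
        ENNReal.ofReal X * wInt w (α i) (η i) +
          ENNReal.ofReal τ * (4 * volume (Cube (α i) (η i))) := by
      intro i
      refine le_trans ?_ (add_le_add (hXF ⟨(α i, η i), H.pos i⟩)
        (mul_le_mul_right (lintegral_exp_min_le hw hpos hA hM hD m (α i) (H.pos i)) _))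
      rw [← lintegral_const_mul' _ _ ENNReal.ofReal_ne_top, ← lintegral_add_right']
      · refine lintegral_mono_ae ?_
        filter_upwards [hR i, ae_restrict_of_ae hpos, ae_restrict_of_ae hM,
          ae_restrict_mem (measurableSet_cube (α i) (η i))] with x hx hwx hMx hxE
        have hs := relWeight_le hA hwx (weightAvg_le_of_maxFn_le hw hA.le hMx hh (H.subset i hxE))
        have h3 := exp_min_le (m := m) hx (by positivity)
        have h4 := exp_sub_one_le hs (by positivity)
        set G := Real.exp (min (D (α i) (η i) x) m)
        have hG : 0 < G := Real.exp_pos _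
        rw [← ENNReal.ofReal_mul' hwx.le, ← ENNReal.ofReal_mul' hwx.le,
          ← ENNReal.ofReal_mul hτ0.le]
        refine le_trans (ENNReal.ofReal_le_ofReal ?_) ENNReal.ofReal_add_le
        rw [← hsx hwx]
        have h5 : G * (Real.exp (W / (8 * A * w x)) - 1) ≤ G * (4 / 3 * (W / (8 * A * w x))) :=
          mul_le_mul_of_nonneg_left h4 hG.le
        have h6 : Real.exp (min (D a h x) m) - 1 ≤
            (G - 1) + W / (8 * A * w x) * (4 / 3) * G := by linarith
        calc _ ≤ ((G - 1) + W / (8 * A * w x) * (4 / 3) * G) * w x :=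
              mul_le_mul_of_nonneg_right h6 hwx.le
          _ = _ := by ring
      · exact (((Real.measurable_exp.comp_aemeasurable
          ((hDm (α i) (η i)).min aemeasurable_const)).ennreal_ofReal).const_mul _).restrict
    have hwE : ENNReal.ofReal (W / A) * volume E ≤ ∫⁻ x in E, ENNReal.ofReal (w x) := by
      rw [← setLIntegral_const]
      refine lintegral_mono_ae ?_
      filter_upwards [ae_restrict_of_ae hM, ae_restrict_mem hEm] with x hMx hxE
      refine ENNReal.ofReal_le_ofReal ?_
      rw [div_le_iff₀ hA, mul_comm]
      exact weightAvg_le_of_maxFn_le hw hA.le hMx hh hxE.1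
    have hwQ : wInt w a h = (∫⁻ x in E, ENNReal.ofReal (w x)) + ∑' i, wInt w (α i) (η i) :=
      H.lintegral_eq _
    have hvQ := H.volume_eq
    have hv2 := H.volume_le
    rw [H.lintegral_eq]
    refine (add_le_add h1 (ENNReal.tsum_le_tsum h2)).trans ?_
    rw [ENNReal.tsum_add, ENNReal.tsum_mul_left, ENNReal.tsum_mul_left, ENNReal.tsum_mul_left]
    have hqt := wInt_ne_top hw a h
    have hVt := volume_cube_ne_top a h
    rw [← hEdef] at hvQ
    generalize ∑' i, volume (Cube (α i) (η i)) = r at *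
    generalize ∑' i, wInt w (α i) (η i) = rw' at *
    generalize (∫⁻ x in E, ENNReal.ofReal (w x)) = ew at *
    generalize volume E = e at *
    generalize volume (Cube a h) = V at *
    generalize wInt w a h = q at *
    have hrt : r ≠ ⊤ := fun hr => hVt (by rw [hvQ, hr, add_top])
    have het : e ≠ ⊤ := fun hr => hVt (by rw [hvQ, hr, top_add])
    have hrwt : rw' ≠ ⊤ := fun hr => hqt (by rw [hwQ, hr, add_top])
    have hewt : ew ≠ ⊤ := fun hr => hqt (by rw [hwQ, hr, top_add])
    have hex : ∀ {z : ℝ≥0∞}, z ≠ ⊤ → ∃ y : ℝ, 0 ≤ y ∧ z = ENNReal.ofReal y := fun hz =>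
      ⟨_, ENNReal.toReal_nonneg, (ENNReal.ofReal_toReal hz).symm⟩
    obtain ⟨r, hr, rfl⟩ := hex hrt
    obtain ⟨e, he, rfl⟩ := hex het
    obtain ⟨rw', hrw, rfl⟩ := hex hrwt
    obtain ⟨ew, hew, rfl⟩ := hex hewt
    obtain ⟨V, hV, rfl⟩ := hex hVt
    obtain ⟨q, hq, rfl⟩ := hex hqt
    rw [← ENNReal.ofReal_mul hW.le, ENNReal.ofReal_eq_ofReal_iff (by positivity) hq] at hWV
    rw [← ENNReal.ofReal_add he hr, ENNReal.ofReal_eq_ofReal_iff hV (by positivity)] at hvQ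
    rw [← ENNReal.ofReal_add hew hrw, ENNReal.ofReal_eq_ofReal_iff hq (by positivity)] at hwQ
    rw [← ENNReal.ofReal_ofNat 2, ← ENNReal.ofReal_mul (by norm_num),
      ENNReal.ofReal_le_ofReal_iff hV] at hv2
    rw [← ENNReal.ofReal_mul (by positivity), ENNReal.ofReal_le_ofReal_iff hew] at hwE
    rw [← ENNReal.ofReal_ofNat 4, ← ENNReal.ofReal_mul hτ0.le, ← ENNReal.ofReal_mul hX,
      ← ENNReal.ofReal_mul (p := 4) (by norm_num), ← ENNReal.ofReal_mul hτ0.le,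
      ← ENNReal.ofReal_add (by positivity) (by positivity),
      ← ENNReal.ofReal_add (by positivity) (by positivity), ← ENNReal.ofReal_mul' hq]
    refine ENNReal.ofReal_le_ofReal ?_
    have hqe : q / (2 * A) ≤ ew := by
      refine le_trans ?_ hwE
      rw [← hWV, div_mul_eq_mul_div, div_le_div_iff₀ (by positivity) hA]
      have : W * A * V ≤ W * A * (2 * e) := by
        apply mul_le_mul_of_nonneg_left (by linarith) (by positivity)
      linarith
    have hτV : τ * (e + 4 * r) ≤ 5 / (12 * A) * q := by
      have : τ * (e + 4 * r) ≤ τ * (5 / 2 * V) :=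
        mul_le_mul_of_nonneg_left (by linarith) hτ0.le
      refine this.trans (le_of_eq ?_)
      rw [hτ, ← hWV]; field_simp; ring
    have hXe : X * (q / (2 * A)) ≤ X * ew := mul_le_mul_of_nonneg_left hqe hX
    have hfin : (5 / (12 * A) + (1 - 1 / (2 * A)) * X) * q =
        5 / (12 * A) * q + X * q - X * (q / (2 * A)) := by ring
    rw [hfin]
    have : X * q = X * ew + X * rw' := by rw [hwQ]; ring
    linarith

theorem lintegral_exp_sub_one_le (hw : IsWeight w)
    (hpos : ∀ᵐ x ∂(volume : Measure (Fin n → ℝ)), 0 < w x) (hA : 0 < A)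
    (hM : ∀ᵐ x ∂(volume : Measure (Fin n → ℝ)),
      maxFn w x ≤ ENNReal.ofReal A * ENNReal.ofReal (w x))
    (hDm : ∀ a h, AEMeasurable (D a h) volume)
    (hD : HasStep w A D) (a : Fin n → ℝ) {h : ℝ} (hh : 0 < h) :
    ∫⁻ x in Cube a h, ENNReal.ofReal (Real.exp (D a h x) - 1) * ENNReal.ofReal (w x) ≤
      wInt w a h := by
  calc _ ≤ ∫⁻ x in Cube a h, ⨆ m : ℕ,
        ENNReal.ofReal (Real.exp (min (D a h x) m) - 1) * ENNReal.ofReal (w x) := by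
        refine lintegral_mono fun x => ?_
        refine le_iSup_of_le ⌈D a h x⌉₊ ?_
        rw [min_eq_left (Nat.le_ceil _)]
    _ = ⨆ m : ℕ, ∫⁻ x in Cube a h,
        ENNReal.ofReal (Real.exp (min (D a h x) m) - 1) * ENNReal.ofReal (w x) := by
        refine lintegral_iSup' (fun m => ?_) (ae_of_all _ fun x => ?_)
        · exact (((Real.measurable_exp.comp_aemeasurable ((hDm a h).min aemeasurable_const)).sub_const
            1).ennreal_ofReal.mul hw.2.aestronglyMeasurable.aemeasurable.ennreal_ofReal).restrict
        · intro m m' hmm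
          simp only
          gcongr
    _ ≤ wInt w a h := iSup_le fun m => lintegral_exp_min_sub_one_le hw hpos hA hM hDm hD m a hh

end Recursion

theorem ae_pos_of_wInt_ne_zero {n : ℕ} {w : (Fin n → ℝ) → ℝ} {A : ℝ} (hw : IsWeight w)
    (hM : ∀ᵐ x ∂(volume : Measure (Fin n → ℝ)),
      maxFn w x ≤ ENNReal.ofReal A * ENNReal.ofReal (w x))
    {a : Fin n → ℝ} {h : ℝ} (h0 : wInt w a h ≠ 0) :
    ∀ᵐ x ∂(volume : Measure (Fin n → ℝ)), 0 < A ∧ 0 < w x := by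
  filter_upwards [hM] with x hx
  obtain ⟨r, hr, hsub⟩ : ∃ r : ℝ, 0 < r ∧ insert x (Cube a h) ⊆ Cube (fun i => x i - r / 2) r := by
    obtain ⟨r, hr⟩ := (isCompact_cube a h).isBounded.subset_closedBall x
    refine ⟨2 * (|r| + 1), by positivity, ?_⟩
    have h2 : (0 : ℝ) < 2 * (|r| + 1) := by positivity
    have e : (fun i => x i - 2 * (|r| + 1) / 2 + 2 * (|r| + 1) / 2) = x := by
      ext i; ring
    rw [cube_eq_closedBall _ h2, e]
    refine insert_subset (Metric.mem_closedBall_self (by positivity))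
      (hr.trans (Metric.closedBall_subset_closedBall ?_))
    linarith [le_abs_self r]
  set a' : Fin n → ℝ := fun i => x i - r / 2
  have h1 : wInt w a' r ≠ 0 := fun h2 =>
    h0 (le_antisymm ((lintegral_mono_set ((subset_insert _ _).trans hsub)).trans h2.le) bot_le)
  have h3 : 0 < maxFn w x := by
    have e : wInt w a' r = ∫⁻ y in Cube a' r, ENNReal.ofReal |w y| := by
      simp only [wInt, abs_of_nonneg (hw.1 _)]
    have h4 : wInt w a' r / volume (Cube a' r) ≤ maxFn w x := by
      rw [e]
      exact le_iSup₂_of_le a' r (le_iSup₂_of_le hr (hsub (mem_insert _ _)) le_rfl)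
    exact (ENNReal.div_pos h1 (volume_cube_ne_top _ _)).trans_le h4
  have h5 := h3.trans_le hx
  have h6 := ENNReal.mul_pos_iff.1 h5
  simpa using h6

theorem expLuxNorm_zero_measure {X : Type*} [MeasurableSpace X] (g : X → ℝ) (β : ℝ) :
    expLuxNorm (0 : Measure X) β g = 0 := by
  refine le_antisymm (ENNReal.le_of_forall_pos_le_add fun ε hε _ => ?_) bot_le
  rw [zero_add]
  refine iInf₂_le_of_le (ε : ℝ) hε (iInf_le_of_le (by simp) ?_)
  simp

theorem expLuxNorm_relOsc_le {n : ℕ} {w b : (Fin n → ℝ) → ℝ} (hw : IsWeight w)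
    {lam : ℝ} (hlam : 0 < lam) {a : Fin n → ℝ} {h : ℝ} (h0 : wInt w a h ≠ 0)
    (hDm : AEMeasurable (relOsc w b lam a h) volume)
    (hint : ∫⁻ x in Cube a h,
      ENNReal.ofReal (Real.exp (relOsc w b lam a h x) - 1) * ENNReal.ofReal (w x) ≤ wInt w a h) :
    expLuxNorm ((wInt w a h)⁻¹ • wMeasureOn w (Cube a h)) 1
      (fun x => (b x - cubeAvg a h b) / w x) ≤ ENNReal.ofReal lam := by
  refine iInf₂_le_of_le lam hlam (iInf_le_of_le ?_ le_rfl)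
  have e : ∀ x, (|(b x - cubeAvg a h b) / w x| / lam) ^ (1 : ℝ) = relOsc w b lam a h x := by
    intro x
    rw [Real.rpow_one, abs_div, abs_of_nonneg (hw.1 x), div_div, mul_comm (w x), relOsc]
  simp only [e]
  have hG : AEMeasurable (fun x => ENNReal.ofReal (Real.exp (relOsc w b lam a h x) - 1))
      (volume.restrict (Cube a h)) :=
    ((Real.measurable_exp.comp_aemeasurable hDm).sub_const 1).ennreal_ofReal.restrict
  rw [lintegral_smul_measure, wMeasureOn, lintegral_withDensity_eq_lintegral_mul₀
    hw.2.aestronglyMeasurable.aemeasurable.ennreal_ofReal.restrict hG]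
  simp only [Pi.mul_apply, mul_comm (ENNReal.ofReal (w _)), smul_eq_mul]
  calc _ ≤ (wInt w a h)⁻¹ * wInt w a h := by gcongr
    _ = 1 := ENNReal.inv_mul_cancel h0 (wInt_ne_top hw a h)

/-- for `w ∈ A₁` and `b ∈ BMO_{1,w}`, for every cube `Q`,
`‖(b - b_Q)/w‖_{exp L(Q, w dx/w(Q))} ≤ c [w]_{A₁} ‖b‖_{BMO_{1,w}}`. -/
theorem stmt4 (n : ℕ) :
    ∃ c : ℝ, 0 < c ∧
      ∀ (w b : (Fin n → ℝ) → ℝ) (A1 : ℝ), IsWeight w →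
        (∀ᵐ x ∂(volume : Measure (Fin n → ℝ)),
          maxFn w x ≤ ENNReal.ofReal A1 * ENNReal.ofReal (w x)) →
        LocallyIntegrable b volume → bmoVY (fun _ => (1 : ℝ)) (wInt w) b < ⊤ →
        ∀ (a : Fin n → ℝ) (h : ℝ), 0 < h →
          expLuxNorm ((wInt w a h)⁻¹ • wMeasureOn w (Cube a h)) 1
              (fun x => (b x - cubeAvg a h b) / w x)
            ≤ ENNReal.ofReal c * ENNReal.ofReal A1 * bmoVY (fun _ => (1 : ℝ)) (wInt w) b := by
  refine ⟨2 ^ (n + 4), by positivity, fun w b A hw hM hb hB a h hh => ?_⟩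
  by_cases h0 : wInt w a h = 0
  · have hz : wMeasureOn w (Cube a h) = 0 := by
      rw [← Measure.measure_univ_eq_zero, wMeasureOn, withDensity_apply _ MeasurableSet.univ,
        Measure.restrict_univ]
      exact h0
    rw [hz, smul_zero, expLuxNorm_zero_measure]
    exact bot_le
  have hae := ae_pos_of_wInt_ne_zero hw hM h0
  have hA : 0 < A := hae.exists.choose_spec.1
  have hpos : ∀ᵐ x ∂(volume : Measure (Fin n → ℝ)), 0 < w x := hae.mono fun _ hx => hx.2
  have hK0 : ENNReal.ofReal (2 ^ (n + 4)) * ENNReal.ofReal A ≠ 0 := by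
    simp [hA]
  have hKt : ENNReal.ofReal (2 ^ (n + 4)) * ENNReal.ofReal A ≠ ⊤ :=
    ENNReal.mul_ne_top ENNReal.ofReal_ne_top ENNReal.ofReal_ne_top
  rw [mul_comm, ← ENNReal.div_le_iff hK0 hKt]
  refine le_of_forall_gt_imp_ge_of_dense fun β' hβ' => ?_
  rcases eq_or_ne β' ⊤ with rfl | hβt
  · exact le_top
  rw [ENNReal.div_le_iff hK0 hKt]
  set β := β'.toReal with hβdef
  have hβ : 0 < β := ENNReal.toReal_pos (bot_le.trans_lt hβ').ne' hβt
  have hββ : ENNReal.ofReal β = β' := ENNReal.ofReal_toReal hβt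
  have hosc : ∀ (a : Fin n → ℝ) (h : ℝ), 0 < h →
      ∫⁻ x in Cube a h, ENNReal.ofReal |b x - cubeAvg a h b| ≤
        ENNReal.ofReal β * wInt w a h := by
    intro a h hh
    rw [← ENNReal.div_le_iff (wInt_ne_zero hw hpos a hh) (wInt_ne_top hw a h), hββ]
    refine le_trans ?_ hβ'.le
    refine le_trans ?_ (le_iSup₂_of_le a h (le_iSup_of_le hh le_rfl))
    simp
  have hDm : ∀ a h, AEMeasurable (relOsc w b (2 ^ (n + 4) * A * β) a h) volume := fun a h =>
    (continuous_abs.measurable.comp_aemeasurable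
      (hb.aestronglyMeasurable.aemeasurable.sub_const _)).div
      (hw.2.aestronglyMeasurable.aemeasurable.const_mul _)
  refine (expLuxNorm_relOsc_le hw (by positivity) h0 (hDm a h) (lintegral_exp_sub_one_le hw hpos hA
    hM hDm (hasStep_relOsc hw hpos hb hA hβ hosc) a hh)).trans (le_of_eq ?_)
  rw [ENNReal.ofReal_mul (by positivity), ENNReal.ofReal_mul (by positivity), hββ, mul_comm]
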